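/- arXiv:2210.05744 — 6 statements merged into one kernel-verified Lean document; each statement's English description precedes it below -/
import Mathlib

section
/- Ladyzhenskaya's interpolation inequality in the plane: for every continuously differentiable, compactly supported function u : ℝ² → ℂ one has ∫_{ℝ²} |u(x)|⁴ dx ≤ (∫_{ℝ²} |u(x)|² dx) · (∫_{ℝ²} |∂_{x₁}u(x)|² dx)^{1/2} · (∫_{ℝ²} |∂_{x₂}u(x)|² dx)^{1/2}. -/
open MeasureTheory

lemma lady_one_dim (f : ℝ → ℂ) (hf : ContDiff ℝ 1 f) (hs : HasCompactSupport f) (t : ℝ) :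
    ‖f t‖ ^ 2 ≤ ∫ s, ‖f s‖ * ‖deriv f s‖ := by
  have hg : ContDiff ℝ 1 (fun s => ‖f s‖ ^ 2) := hf.norm_sq ℝ
  have hgs : HasCompactSupport (fun s => ‖f s‖ ^ 2) :=
    hs.comp_left (g := fun z : ℂ => ‖z‖ ^ 2) (by simp)
  have h1 := hgs.integral_Iic_deriv_eq hg t
  have h2 := hgs.integral_Ioi_deriv_eq hg t
  have hd : ∀ s, deriv (fun s => ‖f s‖ ^ 2) s = 2 * inner ℝ (f s) (deriv f s) := fun s =>
    ((hf.differentiable one_ne_zero s).hasDerivAt.norm_sq).deriv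
  have hcd : Continuous (deriv (fun s => ‖f s‖ ^ 2)) := hg.continuous_deriv le_rfl
  have hint : Integrable (deriv (fun s => ‖f s‖ ^ 2)) :=
    hcd.integrable_of_hasCompactSupport hgs.deriv
  have hint2 : Integrable (fun s => ‖f s‖ * ‖deriv f s‖) :=
    (hf.continuous.norm.mul (hf.continuous_deriv le_rfl).norm).integrable_of_hasCompactSupport
      (hs.norm.mul_right)
  have h3 : ‖∫ s in Set.Iic t, deriv (fun s => ‖f s‖ ^ 2) s‖ ≤ _ := norm_integral_le_integral_norm _
  have h4 : ‖∫ s in Set.Ioi t, deriv (fun s => ‖f s‖ ^ 2) s‖ ≤ _ := norm_integral_le_integral_norm _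
  have h5 := intervalIntegral.integral_Iic_add_Ioi (b := t) hint.norm.integrableOn
    hint.norm.integrableOn
  have h6 : ∫ s, ‖deriv (fun s => ‖f s‖ ^ 2) s‖ ≤ ∫ s, 2 * (‖f s‖ * ‖deriv f s‖) := by
    refine integral_mono hint.norm (hint2.const_mul 2) fun s => ?_
    simp only [hd, norm_mul, Real.norm_ofNat]
    gcongr
    exact norm_inner_le_norm _ _
  rw [integral_const_mul] at h6
  rw [h1] at h3
  rw [h2, norm_neg] at h4
  simp only [norm_pow, norm_norm] at h3 h4
  linarith

lemma lady_cs (f g : ℝ × ℝ → ℂ) (hf : Continuous f) (hg : Continuous g)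
    (hfs : HasCompactSupport f) (hgs : HasCompactSupport g) :
    ∫ x, ‖f x‖ * ‖g x‖ ≤
      (∫ x, ‖f x‖ ^ 2) ^ ((1 : ℝ) / 2) * (∫ x, ‖g x‖ ^ 2) ^ ((1 : ℝ) / 2) := by
  have := integral_mul_norm_le_Lp_mul_Lq (μ := (volume : Measure (ℝ × ℝ))) (f := f) (g := g)
    Real.HolderConjugate.two_two
    (hf.memLp_of_hasCompactSupport hfs) (hg.memLp_of_hasCompactSupport hgs)
  simpa using this

theorem ladyzhenskaya_inequality
    (u : ℝ × ℝ → ℂ) (hu : ContDiff ℝ 1 u) (hsupp : HasCompactSupport u) :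
    ∫ x : ℝ × ℝ, ‖u x‖ ^ 4 ≤
      (∫ x : ℝ × ℝ, ‖u x‖ ^ 2) *
        (∫ x : ℝ × ℝ, ‖fderiv ℝ u x (1, 0)‖ ^ 2) ^ ((1 : ℝ) / 2) *
        (∫ x : ℝ × ℝ, ‖fderiv ℝ u x (0, 1)‖ ^ 2) ^ ((1 : ℝ) / 2) := by
  have hc : ∀ v, Continuous (fun x => fderiv ℝ u x v) := fun v =>
    (hu.continuous_fderiv one_ne_zero).clm_apply continuous_const
  have hcs : ∀ v, HasCompactSupport (fun x => fderiv ℝ u x v) := fun v =>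
    hsupp.fderiv_apply (𝕜 := ℝ) v
  have hI : ∀ v, Integrable (fun x => ‖u x‖ * ‖fderiv ℝ u x v‖) := fun v =>
    (hu.continuous.norm.mul (hc v).norm).integrable_of_hasCompactSupport hsupp.norm.mul_right
  have hd : Differentiable ℝ u := hu.differentiable one_ne_zero
  have a1 : ∀ x : ℝ × ℝ, ‖u x‖ ^ 2 ≤ ∫ s, ‖u (s, x.2)‖ * ‖fderiv ℝ u (s, x.2) (1, 0)‖ := by
    rintro ⟨a, b⟩
    have := lady_one_dim (fun s => u (s, b)) (hu.comp (contDiff_id.prodMk contDiff_const))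
      (HasCompactSupport.intro (hsupp.isCompact.image continuous_fst) fun s hs => by
        by_contra h
        exact hs ⟨(s, b), subset_tsupport _ h, rfl⟩) a
    have e : ∀ s, deriv (fun s => u (s, b)) s = fderiv ℝ u (s, b) (1, 0) := fun s =>
      ((hd (s, b)).hasFDerivAt.comp_hasDerivAt s
        ((hasDerivAt_id s).prodMk (hasDerivAt_const s b))).deriv
    simpa only [e] using this
  have a2 : ∀ x : ℝ × ℝ, ‖u x‖ ^ 2 ≤ ∫ s, ‖u (x.1, s)‖ * ‖fderiv ℝ u (x.1, s) (0, 1)‖ := by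
    rintro ⟨a, b⟩
    have := lady_one_dim (fun s => u (a, s)) (hu.comp (contDiff_const.prodMk contDiff_id))
      (HasCompactSupport.intro (hsupp.isCompact.image continuous_snd) fun s hs => by
        by_contra h
        exact hs ⟨(a, s), subset_tsupport _ h, rfl⟩) b
    have e : ∀ s, deriv (fun s => u (a, s)) s = fderiv ℝ u (a, s) (0, 1) := fun s =>
      ((hd (a, s)).hasFDerivAt.comp_hasDerivAt s
        ((hasDerivAt_const s a).prodMk (hasDerivAt_id s))).deriv
    simpa only [e] using this
  have i1 := Integrable.integral_prod_right (hI (1, 0))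
  have i2 := Integrable.integral_prod_left (hI (0, 1))
  have i4 : Integrable (fun x => ‖u x‖ ^ 4) := by
    have h4 : HasCompactSupport (fun x => ‖u x‖ ^ 4) :=
      hsupp.comp_left (g := fun z : ℂ => ‖z‖ ^ 4) (by simp)
    have h5 : Continuous (fun x => ‖u x‖ ^ 4) := hu.continuous.norm.pow 4
    exact h5.integrable_of_hasCompactSupport h4
  have b1 : ∫ x : ℝ × ℝ, ‖u x‖ ^ 4 ≤
      (∫ x, ‖u x‖ * ‖fderiv ℝ u x (0, 1)‖) * (∫ x, ‖u x‖ * ‖fderiv ℝ u x (1, 0)‖) := by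
    rw [Measure.volume_eq_prod, integral_prod _ (hI (0, 1)), integral_prod_symm _ (hI (1, 0)),
      ← integral_prod_mul]
    refine integral_mono i4 (i2.mul_prod i1) fun x => ?_
    · calc ‖u x‖ ^ 4 = ‖u x‖ ^ 2 * ‖u x‖ ^ 2 := by ring
        _ ≤ _ := mul_le_mul (a2 x) (a1 x) (by positivity) (le_trans (by positivity) (a2 x))
  refine b1.trans ?_
  have c1 := lady_cs u _ hu.continuous (hc (1, 0)) hsupp (hcs _)
  have c2 := lady_cs u _ hu.continuous (hc (0, 1)) hsupp (hcs _)
  have hsq : (∫ x, ‖u x‖ ^ 2) ^ ((1 : ℝ) / 2) * (∫ x, ‖u x‖ ^ 2) ^ ((1 : ℝ) / 2)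
      = ∫ x, ‖u x‖ ^ 2 := by
    rw [← Real.sqrt_eq_rpow]
    exact Real.mul_self_sqrt (integral_nonneg fun x => by positivity)
  refine (mul_le_mul c2 c1 (integral_nonneg fun x => by positivity)
    (by positivity)).trans (le_of_eq ?_)
  generalize (∫ x, ‖u x‖ ^ 2) ^ ((1 : ℝ) / 2) = A at *
  rw [← hsq]
  ring
end

section
/- Energy estimate for the shifted Laplacian (Lemma 2.1 for test functions): let κ > 0, let u : ℝ² → ℂ be smooth and compactly supported, and set g := −Δu + κ²u, where Δu = ∂_{x₁}²u + ∂_{x₂}²u. Then ∫_{ℝ²} |∇u|² dx + κ² ∫_{ℝ²} |u|² dx ≤ (1/(κ√8)) · (∫_{ℝ²} |g|^{4/3} dx)^{3/2}. -/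
open MeasureTheory

lemma oneD_bound (f : ℝ → ℂ) (hf : ContDiff ℝ 1 f) (hs : HasCompactSupport f) (x : ℝ) :
    ‖f x‖ ^ 2 ≤ ∫ t, ‖f t‖ * ‖deriv f t‖ := by
  set F : ℝ → ℝ := fun t => ‖f t‖ ^ 2 with hF
  have hFc : ContDiff ℝ 1 F := hf.norm_sq ℝ
  have hFs : HasCompactSupport F := by
    have := hs.comp_left (g := fun z : ℂ => ‖z‖ ^ 2) (by simp)
    exact this
  have hb : ∀ t, ‖deriv F t‖ ≤ 2 * (‖f t‖ * ‖deriv f t‖) := by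
    intro t
    have h1 : HasDerivAt F _ t := ((hf.differentiable one_ne_zero t).hasDerivAt).norm_sq
    rw [h1.deriv, norm_mul]
    have := norm_inner_le_norm (𝕜 := ℝ) (f t) (deriv f t)
    simp only [Real.norm_ofNat]
    linarith
  have hint : Integrable (fun t => 2 * (‖f t‖ * ‖deriv f t‖)) := by
    have hd := hf.continuous_deriv le_rfl
    have hc := hf.continuous
    apply Integrable.const_mul
    apply Continuous.integrable_of_hasCompactSupport (by fun_prop)
    exact hs.norm.mul_right
  have hd : Integrable (deriv F) :=
    (hFc.continuous_deriv le_rfl).integrable_of_hasCompactSupport hFs.deriv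
  have h1 := hFs.integral_Iic_deriv_eq hFc x
  have h2 := hFs.integral_Ioi_deriv_eq hFc x
  have e1 : F x ≤ ∫ t in Set.Iic x, 2 * (‖f t‖ * ‖deriv f t‖) := by
    rw [← h1]
    exact integral_mono hd.integrableOn hint.integrableOn
      (fun t => (le_abs_self _).trans (hb t))
  have e2 : F x ≤ ∫ t in Set.Ioi x, 2 * (‖f t‖ * ‖deriv f t‖) := by
    have : F x = ∫ t in Set.Ioi x, - deriv F t := by rw [integral_neg, h2, neg_neg]
    rw [this]
    exact integral_mono hd.neg.integrableOn hint.integrableOn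
      (fun t => (neg_le_abs _).trans (hb t))
  have e3 := intervalIntegral.integral_Iic_add_Ioi (b := x) hint.integrableOn hint.integrableOn
  have e4 : ∫ t, 2 * (‖f t‖ * ‖deriv f t‖) = 2 * ∫ t, ‖f t‖ * ‖deriv f t‖ :=
    integral_const_mul _ _
  change F x ≤ _
  linarith

lemma cs_sq (a b : ℝ × ℝ → ℂ) (ha : Continuous a) (hb : Continuous b)
    (has : HasCompactSupport a) (hbs : HasCompactSupport b) :
    (∫ x, ‖a x‖ * ‖b x‖) ^ 2 ≤ (∫ x, ‖a x‖ ^ 2) * ∫ x, ‖b x‖ ^ 2 := by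
  have h := integral_mul_norm_le_Lp_mul_Lq (μ := (volume : Measure (ℝ × ℝ)))
    Real.HolderConjugate.two_two
    (ha.memLp_of_hasCompactSupport has) (hb.memLp_of_hasCompactSupport hbs)
  have h0 : 0 ≤ ∫ x, ‖a x‖ * ‖b x‖ := integral_nonneg fun x => by positivity
  simp only [Real.rpow_two, ← Real.sqrt_eq_rpow] at h
  calc _ ≤ _ := pow_le_pow_left₀ h0 h 2
    _ = _ := by
      rw [mul_pow, Real.sq_sqrt (integral_nonneg fun x => by positivity),
        Real.sq_sqrt (integral_nonneg fun x => by positivity)]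

lemma lady (u : ℝ × ℝ → ℂ)
    (hu : ContDiff ℝ (⊤ : ℕ∞) u) (hs : HasCompactSupport u) :
    ∫ x, ‖u x‖ ^ 4 ≤ (∫ x, ‖u x‖ * ‖fderiv ℝ u x (1, 0)‖) *
      ∫ x, ‖u x‖ * ‖fderiv ℝ u x (0, 1)‖ := by
  have hc := hu.continuous
  have hdc : ∀ v, Continuous fun x => fderiv ℝ u x v := fun v =>
    (hu.continuous_fderiv (by simp)).clm_apply continuous_const
  have hi : ∀ v, Integrable (fun x => ‖u x‖ * ‖fderiv ℝ u x v‖) (volume.prod volume) := by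
    intro v
    have := hdc v
    apply Continuous.integrable_of_hasCompactSupport (by fun_prop)
    exact hs.norm.mul_right
  have hdiff : Differentiable ℝ u := hu.differentiable (by simp)
  have b1 : ∀ x y : ℝ, ‖u (x, y)‖ ^ 2 ≤ ∫ t, ‖u (t, y)‖ * ‖fderiv ℝ u (t, y) (1, 0)‖ := by
    intro x y
    have hder : ∀ t, deriv (fun t => u (t, y)) t = fderiv ℝ u (t, y) (1, 0) := by
      intro t
      have hh : HasDerivAt (fun t : ℝ => (t, y)) ((1 : ℝ), (0 : ℝ)) t :=
        (hasDerivAt_id t).prodMk (hasDerivAt_const t y)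
      exact ((hdiff (t, y)).hasFDerivAt.comp_hasDerivAt t hh).deriv
    have := oneD_bound (fun t => u (t, y))
      ((hu.of_le (by norm_cast)).comp (contDiff_id.prodMk contDiff_const))
      (HasCompactSupport.intro (hs.isCompact.image continuous_fst) (fun t ht => by
        by_contra h
        exact ht ⟨(t, y), subset_tsupport _ h, rfl⟩)) x
    simpa only [hder] using this
  have b2 : ∀ x y : ℝ, ‖u (x, y)‖ ^ 2 ≤ ∫ t, ‖u (x, t)‖ * ‖fderiv ℝ u (x, t) (0, 1)‖ := by
    intro x y
    have hder : ∀ t, deriv (fun t => u (x, t)) t = fderiv ℝ u (x, t) (0, 1) := by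
      intro t
      have hh : HasDerivAt (fun t : ℝ => (x, t)) ((0 : ℝ), (1 : ℝ)) t :=
        (hasDerivAt_const t x).prodMk (hasDerivAt_id t)
      exact ((hdiff (x, t)).hasFDerivAt.comp_hasDerivAt t hh).deriv
    have := oneD_bound (fun t => u (x, t))
      ((hu.of_le (by norm_cast)).comp (contDiff_const.prodMk contDiff_id))
      (HasCompactSupport.intro (hs.isCompact.image continuous_snd) (fun t ht => by
        by_contra h
        exact ht ⟨(x, t), subset_tsupport _ h, rfl⟩)) y
    simpa only [hder] using this
  have i1 := (hi (1, 0)).integral_prod_right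
  have i2 := (hi (0, 1)).integral_prod_left
  have e1 := integral_prod_symm _ (hi (1, 0))
  have e2 := integral_prod _ (hi (0, 1))
  have key := integral_prod_mul (μ := (volume : Measure ℝ)) (ν := (volume : Measure ℝ))
    (fun x : ℝ => ∫ t, ‖u (x, t)‖ * ‖fderiv ℝ u (x, t) (0, 1)‖)
    (fun y : ℝ => ∫ t, ‖u (t, y)‖ * ‖fderiv ℝ u (t, y) (1, 0)‖)
  rw [Measure.volume_eq_prod, e1, e2, mul_comm, ← key]
  refine integral_mono ?_ (i2.mul_prod i1) ?_
  · apply Continuous.integrable_of_hasCompactSupport (by fun_prop)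
    exact hs.comp_left (g := fun z : ℂ => ‖z‖ ^ 4) (by simp)
  · rintro ⟨x, y⟩
    have h1 := b1 x y
    have h2 := b2 x y
    have : ‖u (x, y)‖ ^ 4 = ‖u (x, y)‖ ^ 2 * ‖u (x, y)‖ ^ 2 := by ring
    simp only [this]
    exact mul_le_mul h2 h1 (by positivity) (le_trans (by positivity) h2)

lemma ibp (u : ℝ × ℝ → ℂ)
    (hu : ContDiff ℝ (⊤ : ℕ∞) u) (hs : HasCompactSupport u) (v : ℝ × ℝ) :
    Integrable (fun x => inner ℝ (u x) (fderiv ℝ (fun y => fderiv ℝ u y v) x v)) ∧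
    ∫ x, inner ℝ (u x) (fderiv ℝ (fun y => fderiv ℝ u y v) x v) =
      - ∫ x, ‖fderiv ℝ u x v‖ ^ 2 := by
  have hc := hu.continuous
  have hd : ContDiff ℝ (⊤ : ℕ∞) fun x => fderiv ℝ u x v :=
    (hu.fderiv_right (m := (⊤ : ℕ∞)) (by simp)).clm_apply contDiff_const
  have hdc := hd.continuous
  have hddc : Continuous fun x => fderiv ℝ (fun y => fderiv ℝ u y v) x v :=
    (hd.continuous_fderiv (by simp)).clm_apply continuous_const
  have hds : HasCompactSupport fun x => fderiv ℝ u x v := hs.fderiv_apply (𝕜 := ℝ) v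
  have gen : ∀ a b : ℝ × ℝ → ℂ, Continuous a → Continuous b → HasCompactSupport a →
      Integrable (fun x => innerSL ℝ (a x) (b x)) := by
    intro a b ha hb h
    apply Continuous.integrable_of_hasCompactSupport
    · simp only [innerSL_apply_apply]; fun_prop
    · refine h.mono ?_
      intro x hx hx'
      exact hx (by simp [hx'])
  refine ⟨gen _ _ hc hddc hs, ?_⟩
  have := integral_bilinear_fderiv_right_eq_neg_left_of_integrable
    (μ := (volume : Measure (ℝ × ℝ))) (f := u) (g := fun x => fderiv ℝ u x v) (v := v)
    (B := innerSL ℝ) (gen _ _ hdc hdc hds) (gen _ _ hc hddc hs) (gen _ _ hc hdc hs)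
    (fun x _ => hu.differentiable (by simp) x) (fun x _ => hd.differentiable (by simp) x)
  simp only [← real_inner_self_eq_norm_sq]
  exact this

lemma final_alg (κ D1 D2 N A G P1 P2 : ℝ) (hκ : 0 < κ) (hD1 : 0 ≤ D1) (hD2 : 0 ≤ D2)
    (hN : 0 ≤ N) (hA : 0 ≤ A) (hG : 0 ≤ G) (hP1 : 0 ≤ P1) (hP2 : 0 ≤ P2)
    (l : A ≤ P1 * P2) (c1 : P1 ^ 2 ≤ N * D1) (c2 : P2 ^ 2 ≤ N * D2)
    (hEH : D1 + D2 + κ ^ 2 * N ≤ A ^ (1 / (4 : ℝ)) * G ^ (1 / ((4 : ℝ) / 3))) :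
    D1 + D2 + κ ^ 2 * N ≤ 1 / (κ * Real.sqrt 8) * G ^ ((3 : ℝ) / 2) := by
  have hE0 : 0 ≤ D1 + D2 + κ ^ 2 * N := by positivity
  have hA2 : 8 * κ ^ 2 * A ≤ (D1 + D2 + κ ^ 2 * N) ^ 2 := by
    have h1 : 2 * A ≤ N * (D1 + D2) := by nlinarith [sq_nonneg (P1 - P2)]
    have h2 : κ ^ 2 * (2 * A) ≤ κ ^ 2 * (N * (D1 + D2)) := by gcongr
    nlinarith [sq_nonneg (D1 + D2 - κ ^ 2 * N)]
  set E := D1 + D2 + κ ^ 2 * N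
  have h4 : E ^ 4 ≤ A * G ^ 3 := by
    calc E ^ 4 ≤ (A ^ (1 / (4 : ℝ)) * G ^ (1 / ((4 : ℝ) / 3))) ^ 4 := by gcongr
      _ = A * G ^ 3 := by
        rw [mul_pow, ← Real.rpow_natCast, ← Real.rpow_natCast, ← Real.rpow_mul hA,
          ← Real.rpow_mul hG, ← Real.rpow_natCast G 3]
        norm_num
  rcases hE0.eq_or_lt with h | h
  · rw [← h]; positivity
  have h5 : 8 * κ ^ 2 * E ^ 2 ≤ G ^ 3 := by
    have : E ^ 2 * (8 * κ ^ 2 * E ^ 2) ≤ E ^ 2 * G ^ 3 := by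
      calc _ = 8 * κ ^ 2 * E ^ 4 := by ring
        _ ≤ 8 * κ ^ 2 * (A * G ^ 3) := by gcongr
        _ = 8 * κ ^ 2 * A * G ^ 3 := by ring
        _ ≤ _ := by gcongr
    exact le_of_mul_le_mul_left this (by positivity)
  have h6 : κ * Real.sqrt 8 * E ≤ G ^ ((3 : ℝ) / 2) := by
    refine (sq_le_sq₀ (by positivity) (by positivity)).1 ?_
    have e : (G ^ ((3 : ℝ) / 2)) ^ 2 = G ^ 3 := by
      rw [← Real.rpow_natCast, ← Real.rpow_mul hG, ← Real.rpow_natCast G 3]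
      norm_num
    rw [e, mul_pow, mul_pow, Real.sq_sqrt (by norm_num)]
    linarith
  rw [one_div, ← div_eq_inv_mul, le_div_iff₀ (by positivity)]
  linarith

/-- Energy estimate for the shifted Laplacian: for `κ > 0`, `u` smooth and compactly
supported, and `g = -Δu + κ²u`, one has
`∫ |∇u|² + κ² ∫ |u|² ≤ (1/(κ√8)) (∫ |g|^{4/3})^{3/2}`. -/
theorem energy_estimate_shifted_laplacian
    (κ : ℝ) (hκ : 0 < κ) (u : ℝ × ℝ → ℂ)
    (hu : ContDiff ℝ (⊤ : ℕ∞) u) (hsupp : HasCompactSupport u)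
    (g : ℝ × ℝ → ℂ)
    (hg : g = fun x =>
      -(fderiv ℝ (fun y => fderiv ℝ u y (1, 0)) x (1, 0)
          + fderiv ℝ (fun y => fderiv ℝ u y (0, 1)) x (0, 1))
        + (κ : ℂ) ^ 2 * u x) :
    (∫ x : ℝ × ℝ, ‖fderiv ℝ u x (1, 0)‖ ^ 2 + ‖fderiv ℝ u x (0, 1)‖ ^ 2)
        + κ ^ 2 * ∫ x : ℝ × ℝ, ‖u x‖ ^ 2 ≤
      (1 / (κ * Real.sqrt 8)) * (∫ x : ℝ × ℝ, ‖g x‖ ^ ((4 : ℝ) / 3)) ^ ((3 : ℝ) / 2) := by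
  have hc := hu.continuous
  have hd : ∀ v, ContDiff ℝ (⊤ : ℕ∞) fun x => fderiv ℝ u x v := fun v =>
    (hu.fderiv_right (m := (⊤ : ℕ∞)) (by simp)).clm_apply contDiff_const
  have hdc := fun v => (hd v).continuous
  have hds : ∀ v, HasCompactSupport fun x => fderiv ℝ u x v :=
    fun v => hsupp.fderiv_apply (𝕜 := ℝ) v
  have hddc : ∀ v, Continuous fun x => fderiv ℝ (fun y => fderiv ℝ u y v) x v := fun v =>
    ((hd v).continuous_fderiv (by simp)).clm_apply continuous_const
  have hdds : ∀ v, HasCompactSupport fun x => fderiv ℝ (fun y => fderiv ℝ u y v) x v :=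
    fun v => (hds v).fderiv_apply (𝕜 := ℝ) v
  have hgc : Continuous g := by
    have h1 := hddc (1, 0)
    have h2 := hddc (0, 1)
    rw [hg]; fun_prop
  have hgs : HasCompactSupport g := by
    rw [hg]
    exact ((hdds (1, 0)).add (hdds (0, 1))).neg.add hsupp.mul_left
  have sqi : ∀ a : ℝ × ℝ → ℂ, Continuous a → HasCompactSupport a →
      Integrable (fun x => ‖a x‖ ^ 2) := by
    intro a ha h
    apply Continuous.integrable_of_hasCompactSupport (by fun_prop)
    exact h.comp_left (g := fun z : ℂ => ‖z‖ ^ 2) (by simp)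
  obtain ⟨j1, k1⟩ := ibp u hu hsupp (1, 0)
  obtain ⟨j2, k2⟩ := ibp u hu hsupp (0, 1)
  have l := lady u hu hsupp
  have c1 := cs_sq u _ hc (hdc (1, 0)) hsupp (hds (1, 0))
  have c2 := cs_sq u _ hc (hdc (0, 1)) hsupp (hds (0, 1))
  rw [integral_add (sqi _ (hdc (1, 0)) (hds _)) (sqi _ (hdc (0, 1)) (hds _))]
  have hE : ∫ x, inner ℝ (u x) (g x) = (∫ x, ‖fderiv ℝ u x (1, 0)‖ ^ 2)
      + (∫ x, ‖fderiv ℝ u x (0, 1)‖ ^ 2) + κ ^ 2 * ∫ x, ‖u x‖ ^ 2 := by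
    have : ∀ x, inner ℝ (u x) (g x) =
        (-inner ℝ (u x) (fderiv ℝ (fun y => fderiv ℝ u y (1, 0)) x (1, 0))
        + -inner ℝ (u x) (fderiv ℝ (fun y => fderiv ℝ u y (0, 1)) x (0, 1)))
        + κ ^ 2 * ‖u x‖ ^ 2 := by
      intro x
      have hk : (κ : ℂ) ^ 2 * u x = (κ ^ 2 : ℝ) • u x := by
        rw [Complex.real_smul]; push_cast; rfl
      simp only [hg]
      rw [hk, inner_add_right, inner_neg_right, inner_add_right, inner_smul_right,
        real_inner_self_eq_norm_sq]
      ring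
    simp only [this]
    have n1 : Integrable (fun x =>
        -inner ℝ (u x) (fderiv ℝ (fun y => fderiv ℝ u y (1, 0)) x (1, 0))) := j1.neg
    have n2 : Integrable (fun x =>
        -inner ℝ (u x) (fderiv ℝ (fun y => fderiv ℝ u y (0, 1)) x (0, 1))) := j2.neg
    have n3 : Integrable (fun x =>
        -inner ℝ (u x) (fderiv ℝ (fun y => fderiv ℝ u y (1, 0)) x (1, 0)) +
        -inner ℝ (u x) (fderiv ℝ (fun y => fderiv ℝ u y (0, 1)) x (0, 1))) := n1.add n2
    rw [integral_add n3 ((sqi u hc hsupp).const_mul _),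
      integral_add n1 n2, integral_neg, integral_neg, k1, k2, integral_const_mul]
    ring
  have hEle : ∫ x, inner ℝ (u x) (g x) ≤ ∫ x, ‖u x‖ * ‖g x‖ := by
    apply integral_mono
    · apply Continuous.integrable_of_hasCompactSupport (by fun_prop)
      refine hsupp.mono ?_
      intro x hx hx'
      exact hx (by simp [hx'])
    · apply Continuous.integrable_of_hasCompactSupport (by fun_prop)
      exact hsupp.norm.mul_right
    · exact fun x => real_inner_le_norm _ _
  have hH := integral_mul_norm_le_Lp_mul_Lq (μ := (volume : Measure (ℝ × ℝ)))
    (p := 4) (q := 4 / 3) (by rw [Real.holderConjugate_iff]; norm_num)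
    (hc.memLp_of_hasCompactSupport hsupp) (hgc.memLp_of_hasCompactSupport hgs)
  have hr : ∀ x, ‖u x‖ ^ (4 : ℝ) = ‖u x‖ ^ 4 := fun x => by
    rw [← Real.rpow_natCast]; norm_num
  simp only [hr] at hH
  rw [hE] at hEle
  have hD1 : 0 ≤ ∫ x, ‖fderiv ℝ u x (1, 0)‖ ^ 2 := integral_nonneg fun x => by positivity
  have hD2 : 0 ≤ ∫ x, ‖fderiv ℝ u x (0, 1)‖ ^ 2 := integral_nonneg fun x => by positivity
  have hN : 0 ≤ ∫ x, ‖u x‖ ^ 2 := integral_nonneg fun x => by positivity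
  have hA : 0 ≤ ∫ x, ‖u x‖ ^ 4 := integral_nonneg fun x => by positivity
  have hG : 0 ≤ ∫ x, ‖g x‖ ^ ((4 : ℝ) / 3) := integral_nonneg fun x => by positivity
  have hP1 : 0 ≤ ∫ x, ‖u x‖ * ‖fderiv ℝ u x (1, 0)‖ := integral_nonneg fun x => by positivity
  have hP2 : 0 ≤ ∫ x, ‖u x‖ * ‖fderiv ℝ u x (0, 1)‖ := integral_nonneg fun x => by positivity
  have hEH := hEle.trans hH
  clear hEle hH hE k1 k2 j1 j2
  generalize (∫ x, ‖fderiv ℝ u x (1, 0)‖ ^ 2) = D1 at *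
  generalize (∫ x, ‖fderiv ℝ u x (0, 1)‖ ^ 2) = D2 at *
  generalize (∫ x, ‖u x‖ ^ 2) = N at *
  generalize (∫ x, ‖u x‖ ^ 4) = A at *
  generalize (∫ x, ‖g x‖ ^ ((4 : ℝ) / 3)) = G at *
  generalize (∫ x, ‖u x‖ * ‖fderiv ℝ u x (1, 0)‖) = P1 at *
  generalize (∫ x, ‖u x‖ * ‖fderiv ℝ u x (0, 1)‖) = P2 at *
  exact final_alg κ D1 D2 N A G P1 P2 hκ hD1 hD2 hN hA hG hP1 hP2 l c1 c2 hEH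
end

section
/- Hardy-type inequality over the rightward shadow of an obstacle: let 𝒪 ⊂ ℝ² be compact with x₁ > 0 for every x = (x₁,x₂) ∈ 𝒪, and let W = {(x₁ + t, x₂) : (x₁,x₂) ∈ 𝒪, t ≥ 0}. Let u : ℝ² → ℂ be smooth and compactly supported with supp u ∩ 𝒪 = ∅. Then for every s > 0: ∫_W x₁^{−1−s} |u(x)|² dx ≤ (4/s²) ∫_W x₁^{1−s} |∂_{x₁}u(x)|² dx. -/
open MeasureTheory

theorem aux_integrableOn {X : Type*} [TopologicalSpace X] [MeasurableSpace X] [T2Space X]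
    [OpensMeasurableSpace X] [TopologicalSpace.PseudoMetrizableSpace X]
    {μ : Measure X} [IsFiniteMeasureOnCompacts μ] (F : X → ℝ) (W K : Set X) (hW : IsClosed W)
    (hK : IsCompact K) (hF : ContinuousOn F W) (h0 : ∀ x, x ∉ K → F x = 0) :
    IntegrableOn F W μ := by
  have h1 : IntegrableOn F (W ∩ K) μ :=
    (hF.mono Set.inter_subset_left).integrableOn_compact (hK.inter_left hW)
  refine h1.of_forall_sdiff_eq_zero hW.measurableSet ?_
  intro x hx
  exact h0 x fun hk => hx.2 ⟨hx.1, hk⟩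

theorem aux_pt (s x p q r : ℝ) (hs : 0 < s) (hx : 0 < x) (hr : r ≤ p * q) :
    (2 / s) * ((-s * x ^ (-s - 1)) * p ^ 2 + x ^ (-s) * (2 * r)) ≤
      (4 / s ^ 2) * (x ^ (1 - s) * q ^ 2) - x ^ (-1 - s) * p ^ 2 := by
  have e1 : x ^ (-s) = x ^ (-1 - s) * x := by
    rw [← Real.rpow_add_one hx.ne']; congr 1; ring
  have e2 : x ^ (1 - s) = x ^ (-1 - s) * x * x := by
    rw [← Real.rpow_add_one hx.ne', ← Real.rpow_add_one hx.ne']; congr 1; ring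
  have e3 : x ^ (-s - 1) = x ^ (-1 - s) := by congr 1; ring
  rw [e1, e2, e3]
  have hA : 0 < x ^ (-1 - s) := Real.rpow_pos_of_pos hx _
  generalize x ^ (-1 - s) = A at *
  have h1 : (2 / s) * ((-s * A) * p ^ 2 + A * x * (2 * r)) ≤
      (2 / s) * ((-s * A) * p ^ 2 + A * x * (2 * (p * q))) := by gcongr
  refine h1.trans ?_
  have : (4 / s ^ 2) * (A * x * x * q ^ 2) - A * p ^ 2 -
      (2 / s) * ((-s * A) * p ^ 2 + A * x * (2 * (p * q))) = A * (2 / s * x * q - p) ^ 2 := by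
    field_simp
    ring
  have h2 : 0 ≤ A * (2 / s * x * q - p) ^ 2 := by positivity
  linarith

theorem aux_one (f : ℝ → ℂ) (hf : ContDiff ℝ 1 f) (hc : HasCompactSupport f) (a s : ℝ)
    (ha : 0 < a) (hs : 0 < s) (hfa : f a = 0) :
    0 ≤ ∫ x in Set.Ici a, ((4 / s ^ 2) * (x ^ (1 - s) * ‖deriv f x‖ ^ 2) -
      x ^ (-1 - s) * ‖f x‖ ^ 2) := by
  have hrp : ∀ p : ℝ, ContinuousOn (fun x : ℝ => x ^ p) (Set.Ici a) := fun p x hx =>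
    (Real.continuousAt_rpow_const x p (Or.inl (ha.trans_le hx).ne')).continuousWithinAt
  have hfc : Continuous f := hf.continuous
  have hdc : Continuous (deriv f) := hf.continuous_deriv le_rfl
  have hf0 : ∀ x, x ∉ tsupport f → f x = 0 := fun x hx => image_eq_zero_of_notMem_tsupport hx
  have hd0 : ∀ x, x ∉ tsupport f → deriv f x = 0 := fun x hx => by
    by_contra h
    exact hx (support_deriv_subset h)
  let g' : ℝ → ℝ := fun x => (-s * x ^ (-s - 1)) * ‖f x‖ ^ 2 +
    x ^ (-s) * (2 * inner ℝ (f x) (deriv f x))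
  have hg'i : IntegrableOn g' (Set.Ici a) := by
    refine aux_integrableOn _ _ _ isClosed_Ici hc ?_ ?_
    · have := hrp (-s - 1)
      have := hrp (-s)
      exact ((continuousOn_const.mul (hrp (-s-1))).mul (by fun_prop)).add
        ((hrp (-s)).mul (by fun_prop))
    · intro x hx
      simp [g', hf0 x hx]
  have hFi : IntegrableOn (fun x : ℝ => (4 / s ^ 2) * (x ^ (1 - s) * ‖deriv f x‖ ^ 2) -
      x ^ (-1 - s) * ‖f x‖ ^ 2) (Set.Ici a) := by
    refine aux_integrableOn _ _ _ isClosed_Ici hc ?_ ?_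
    · exact (continuousOn_const.mul ((hrp _).mul (by fun_prop))).sub
        ((hrp _).mul (by fun_prop))
    · intro x hx
      simp [hf0 x hx, hd0 x hx]
  have hder : ∀ x ∈ Set.Ici a, HasDerivAt (fun x : ℝ => x ^ (-s) * ‖f x‖ ^ 2) (g' x) x := by
    intro x hx
    have hx0 : 0 < x := ha.trans_le hx
    exact (Real.hasDerivAt_rpow_const (Or.inl hx0.ne')).mul
      ((hf.differentiable one_ne_zero x).hasDerivAt.norm_sq)
  have hlim : Filter.Tendsto (fun x : ℝ => x ^ (-s) * ‖f x‖ ^ 2) Filter.atTop (nhds 0) := by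
    refine tendsto_const_nhds.congr' ?_
    have : ∀ᶠ x in Filter.atTop, x ∉ tsupport f := by
      obtain ⟨b, hb⟩ := hc.isCompact.bddAbove
      filter_upwards [Filter.eventually_gt_atTop b] with x hx h
      exact absurd (hb h) (not_le.2 hx)
    filter_upwards [this] with x hx
    simp [hf0 x hx]
  have hint := integral_Ioi_of_hasDerivAt_of_tendsto' hder
    (hg'i.mono_set Set.Ioi_subset_Ici_self) hlim
  have hmono : ∫ x in Set.Ici a, (2 / s) * g' x ≤ ∫ x in Set.Ici a,
      ((4 / s ^ 2) * (x ^ (1 - s) * ‖deriv f x‖ ^ 2) - x ^ (-1 - s) * ‖f x‖ ^ 2) := by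
    refine setIntegral_mono_on (hg'i.const_mul _) hFi measurableSet_Ici ?_
    intro x hx
    exact aux_pt s x _ _ _ hs (ha.trans_le hx) (real_inner_le_norm _ _)
  rw [integral_const_mul, integral_Ici_eq_integral_Ioi, hint] at hmono
  simpa [hfa] using hmono

open scoped Pointwise in
theorem aux_closed (𝒪 W : Set (ℝ × ℝ)) (h𝒪 : IsCompact 𝒪)
    (hW : W = {y : ℝ × ℝ | ∃ x ∈ 𝒪, ∃ t : ℝ, 0 ≤ t ∧ y = (x.1 + t, x.2)}) : IsClosed W := by
  have : W = 𝒪 + (Set.Ici (0:ℝ) ×ˢ ({0} : Set ℝ)) := by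
    rw [hW]
    ext y
    simp only [Set.mem_ofPred_eq, Set.mem_add]
    constructor
    · rintro ⟨x, hx, t, ht, rfl⟩
      exact ⟨x, hx, (t, 0), by simpa using ht, by ext <;> simp⟩
    · rintro ⟨x, hx, ⟨t, t'⟩, ht, rfl⟩
      simp only [Set.mem_prod, Set.mem_Ici, Set.mem_singleton_iff] at ht
      exact ⟨x, hx, t, ht.1, by ext <;> simp [ht.2]⟩
  rw [this]
  exact (isClosed_Ici.prod isClosed_singleton).add_left_of_isCompact h𝒪

/-- Hardy-type inequality over the rightward shadow `W` of an obstacle `𝒪`: if `𝒪 ⊆ ℝ²`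
is compact with `x₁ > 0` on `𝒪`, `W = {(x₁+t, x₂) : (x₁,x₂) ∈ 𝒪, t ≥ 0}`, and `u` is
smooth with compact support disjoint from `𝒪`, then for all `s > 0`
`∫_W x₁^{-1-s}|u|² ≤ (4/s²) ∫_W x₁^{1-s}|∂₁u|²`. -/
theorem hardy_inequality_shadow
    (𝒪 : Set (ℝ × ℝ)) (h𝒪 : IsCompact 𝒪) (hpos : ∀ x ∈ 𝒪, 0 < x.1)
    (W : Set (ℝ × ℝ))
    (hW : W = {y : ℝ × ℝ | ∃ x ∈ 𝒪, ∃ t : ℝ, 0 ≤ t ∧ y = (x.1 + t, x.2)})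
    (u : ℝ × ℝ → ℂ) (hu : ContDiff ℝ (⊤ : ℕ∞) u) (hsupp : HasCompactSupport u)
    (hdisj : tsupport u ∩ 𝒪 = ∅)
    (s : ℝ) (hs : 0 < s) :
    ∫ x in W, x.1 ^ (-1 - s) * ‖u x‖ ^ 2 ≤
      (4 / s ^ 2) * ∫ x in W, x.1 ^ (1 - s) * ‖fderiv ℝ u x (1, 0)‖ ^ 2 := by
  have hWc : IsClosed W := by
    exact aux_closed 𝒪 W h𝒪 hW
  have hWpos : ∀ x ∈ W, 0 < x.1 := by
    rw [hW]
    rintro _ ⟨x, hx, t, ht, rfl⟩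
    exact add_pos_of_pos_of_nonneg (hpos x hx) ht
  have hrp : ∀ p : ℝ, ContinuousOn (fun x : ℝ × ℝ => x.1 ^ p) W := fun p =>
    continuousOn_fst.rpow_const fun x hx => Or.inl (hWpos x hx).ne'
  have huc : Continuous u := hu.continuous
  have hdc : Continuous (fun x => fderiv ℝ u x (1, 0)) :=
    (hu.continuous_fderiv (by simp)).clm_apply continuous_const
  have hA : IntegrableOn (fun x : ℝ × ℝ => x.1 ^ (-1 - s) * ‖u x‖ ^ 2) W := by
    refine aux_integrableOn _ _ _ hWc hsupp ((hrp _).mul (by fun_prop)) ?_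
    intro x hx
    simp [image_eq_zero_of_notMem_tsupport hx]
  have hB : IntegrableOn (fun x : ℝ × ℝ => x.1 ^ (1 - s) * ‖fderiv ℝ u x (1, 0)‖ ^ 2) W := by
    refine aux_integrableOn _ _ _ hWc hsupp ((hrp _).mul (by fun_prop)) ?_
    intro x hx
    have : fderiv ℝ u x = 0 := by
      by_contra h
      exact hx (support_fderiv_subset ℝ h)
    simp [this]
  rw [← integral_const_mul, ← sub_nonneg, ← integral_sub (hB.const_mul _) hA]
  have hD := (hB.const_mul (4 / s ^ 2)).sub hA
  rw [← integral_indicator hWc.measurableSet]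
  have hD' := (integrable_indicator_iff hWc.measurableSet).2 hD
  rw [Measure.volume_eq_prod] at hD' ⊢
  erw [integral_prod_symm _ hD']
  refine integral_nonneg fun y => ?_
  by_cases hy : ∃ x, (x, y) ∈ 𝒪
  · have hS : IsCompact ((fun x : ℝ × ℝ => x.1) '' (𝒪 ∩ {x | x.2 = y})) :=
      (h𝒪.inter_right (isClosed_eq continuous_snd continuous_const)).image continuous_fst
    obtain ⟨x₀, hx₀⟩ := hy
    obtain ⟨a, ⟨⟨a', y'⟩, ⟨haO, hay⟩, haa⟩, hmin⟩ := hS.exists_isLeast ⟨x₀, (x₀, y), ⟨hx₀, rfl⟩, rfl⟩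
    simp only [Set.mem_ofPred_eq] at hay haa
    subst hay haa
    have hslice : ∀ x, (x, y') ∈ W ↔ x ∈ Set.Ici a' := by
      intro x
      rw [hW]
      constructor
      · rintro ⟨⟨z, w⟩, hz, t, ht, he⟩
        simp only [Prod.mk.injEq] at he
        obtain ⟨rfl, rfl⟩ := he
        have : a' ≤ z := hmin ⟨(z, y'), ⟨hz, rfl⟩, rfl⟩
        exact this.trans (by linarith)
      · intro hx
        exact ⟨(a', y'), haO, x - a', sub_nonneg.2 hx, by simp⟩
    have hder : ∀ x, deriv (fun x => u (x, y')) x = fderiv ℝ u (x, y') (1, 0) := by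
      intro x
      have h1 : HasFDerivAt u (fderiv ℝ u (x, y')) (x, y') :=
        (hu.differentiable (by simp) _).hasFDerivAt
      exact (h1.comp_hasDerivAt x ((hasDerivAt_id x).prodMk (hasDerivAt_const x y'))).deriv
    have hcs : HasCompactSupport (fun x => u (x, y')) := by
      refine HasCompactSupport.intro (hsupp.isCompact.image continuous_fst) fun x hx => ?_
      by_contra h
      exact hx ⟨(x, y'), subset_tsupport _ h, rfl⟩
    have hua : u (a', y') = 0 := image_eq_zero_of_notMem_tsupport fun h => by
      have : (a', y') ∈ tsupport u ∩ 𝒪 := ⟨h, haO⟩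
      simp [hdisj] at this
    have key := aux_one (fun x => u (x, y'))
      ((hu.of_le (by exact_mod_cast le_top)).comp (contDiff_id.prodMk contDiff_const)) hcs a' s
      (hpos _ haO) hs hua
    rw [← integral_indicator measurableSet_Ici] at key
    refine key.trans_eq (integral_congr_ae (Filter.Eventually.of_forall fun x => ?_))
    beta_reduce
    by_cases hx : x ∈ Set.Ici a'
    · rw [Set.indicator_of_mem hx, Set.indicator_of_mem ((hslice x).2 hx), hder]
      rfl
    · rw [Set.indicator_of_notMem hx, Set.indicator_of_notMem (mt (hslice x).1 hx)]
  · have : ∀ x, (x, y) ∉ W := by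
      intro x
      rw [hW]
      rintro ⟨⟨z, w⟩, hz, t, ht, he⟩
      simp only [Prod.mk.injEq] at he
      obtain ⟨rfl, rfl⟩ := he
      exact hy ⟨z, hz⟩
    simp [this]
end

section
/- Lemma A.1: let 𝒪 ⊂ ℝ² be compact and suppose 𝒪 is polar, i.e. for every smooth compactly supported φ : ℝ² → ℝ and every ε > 0 there exists a smooth compactly supported ψ : ℝ² → ℝ with supp ψ ∩ 𝒪 = ∅ and ∫_{ℝ²} |φ − ψ|² dx + ∫_{ℝ²} ‖∇(φ − ψ)‖² dx < ε. Then the projection of 𝒪 onto any line in ℝ² has one-dimensional Lebesgue measure zero; equivalently, for every v ∈ ℝ², the image {⟨x, v⟩ : x ∈ 𝒪} ⊂ ℝ is a Lebesgue null set. -/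
open MeasureTheory

lemma aux_sq {X : Type*} [TopologicalSpace X] {g : X → ℝ} (hc : HasCompactSupport g) :
    HasCompactSupport (fun t => g t ^ 2) := by
  have := hc.mul_left (f := g)
  have e : (fun t => g t ^ 2) = g * g := by funext t; simp [pow_two]
  rw [e]; exact this

lemma aux_one_dim (g : ℝ → ℝ) (hg : ContDiff ℝ 1 g) (hc : HasCompactSupport g) (t0 : ℝ)
    (h1 : g t0 = 1) : 1 ≤ ∫⁻ t, ENNReal.ofReal (g t ^ 2 + deriv g t ^ 2) := by
  have hd : Continuous (deriv g) := hg.continuous_deriv le_rfl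
  have hint : Integrable (fun t => g t ^ 2 + deriv g t ^ 2) := by
    apply Continuous.integrable_of_hasCompactSupport
    · have := hg.continuous
      fun_prop
    · have e : (fun t => g t ^ 2 + deriv g t ^ 2)
          = (fun t => g t * g t) + (fun t => deriv g t * deriv g t) := by
        funext t; simp [pow_two]
      rw [e]
      exact HasCompactSupport.add (hc.mul_left) (hc.deriv.mul_left)
  have hg2 : ContDiff ℝ 1 (fun t => g t ^ 2) := hg.pow 2
  have hc2 : HasCompactSupport (fun t => g t ^ 2) :=
    aux_sq hc
  have key := HasCompactSupport.integral_Iic_deriv_eq hg2 hc2 t0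
  have hder : ∀ t, deriv (fun t => g t ^ 2) t = 2 * g t * deriv g t := by
    intro t
    have := ((hg.differentiable one_ne_zero) t).hasDerivAt.pow 2
    have h := this.deriv
    simp only [Nat.cast_ofNat, Nat.add_one_sub_one, pow_one] at h
    exact h
  have hi2 : Integrable (deriv (fun t => g t ^ 2)) :=
    (hg2.continuous_deriv le_rfl).integrable_of_hasCompactSupport hc2.deriv
  have h3 : (1:ℝ) ≤ ∫ t, (g t ^ 2 + deriv g t ^ 2) := by
    calc (1:ℝ) = ∫ t in Set.Iic t0, deriv (fun t => g t ^ 2) t := by rw [key]; simp [h1]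
      _ ≤ ∫ t in Set.Iic t0, (g t ^ 2 + deriv g t ^ 2) := by
        apply integral_mono hi2.integrableOn hint.integrableOn
        intro t
        simp only [hder]
        nlinarith [sq_nonneg (g t - deriv g t)]
      _ ≤ _ := setIntegral_le_integral hint (Filter.Eventually.of_forall fun t => by positivity)
  rw [← ofReal_integral_eq_lintegral_ofReal hint (Filter.Eventually.of_forall fun t => by positivity)]
  simpa using ENNReal.ofReal_le_ofReal h3

/-- rotated coordinates -/
noncomputable def auxL (a b : ℝ) (h : a ^ 2 + b ^ 2 ≠ 0) : (ℝ × ℝ) ≃L[ℝ] (ℝ × ℝ) :=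
  LinearEquiv.toContinuousLinearEquiv
  { toFun := fun p => ((p.1 * a - p.2 * b) / (a ^ 2 + b ^ 2), (p.1 * b + p.2 * a) / (a ^ 2 + b ^ 2))
    invFun := fun x => (x.1 * a + x.2 * b, x.2 * a - x.1 * b)
    map_add' := fun p q => by ext <;> simp <;> ring
    map_smul' := fun c p => by ext <;> simp <;> ring
    left_inv := fun p => by ext <;> simp <;> field_simp <;> ring
    right_inv := fun p => by ext <;> simp <;> field_simp <;> ring }

lemma auxL_apply (a b : ℝ) (h : a ^ 2 + b ^ 2 ≠ 0) (p : ℝ × ℝ) : auxL a b h p =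
   ((p.1 * a - p.2 * b) / (a ^ 2 + b ^ 2), (p.1 * b + p.2 * a) / (a ^ 2 + b ^ 2)) := rfl

lemma auxL_symm_apply (a b : ℝ) (h : a ^ 2 + b ^ 2 ≠ 0) (x : ℝ × ℝ) : (auxL a b h).symm x =
   (x.1 * a + x.2 * b, x.2 * a - x.1 * b) := rfl

lemma aux_main (L : (ℝ × ℝ) ≃L[ℝ] (ℝ × ℝ)) : ∃ C : NNReal, ∀ (f : ℝ × ℝ → ℝ),
    ContDiff ℝ (⊤ : ℕ∞) f → HasCompactSupport f → ∀ O : Set (ℝ × ℝ), (∀ x ∈ O, f x = 1) →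
    volume ((fun x => (L.symm x).1) '' O) ≤ C * ENNReal.ofReal ((∫ x : ℝ × ℝ, |f x| ^ 2) +
            (∫ x : ℝ × ℝ, (fderiv ℝ f x (1, 0)) ^ 2 + (fderiv ℝ f x (0, 1)) ^ 2)) := by
  have : (Measure.map L (volume : Measure (ℝ × ℝ))).IsAddHaarMeasure :=
    L.isAddHaarMeasure_map _
  obtain ⟨c, hc⟩ : ∃ c : NNReal, Measure.map L (volume : Measure (ℝ × ℝ)) = c • volume :=
    ⟨_, Measure.isAddLeftInvariant_eq_smul _ _⟩
  set w : ℝ × ℝ := L (0, 1) with hw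
  set K : NNReal := (1 + 2 * (w.1 ^ 2 + w.2 ^ 2)).toNNReal with hK
  have hKr : (K : ℝ) = 1 + 2 * (w.1 ^ 2 + w.2 ^ 2) := Real.coe_toNNReal _ (by positivity)
  refine ⟨c * K, fun f hf hcs O hO => ?_⟩
  have hf1 : ContDiff ℝ 1 f := hf.of_le (by exact_mod_cast le_top)
  have hfd : Continuous (fderiv ℝ f) := hf1.continuous_fderiv one_ne_zero
  have hfc : Continuous f := hf.continuous
  have hcd : ∀ u, Continuous (fun x => fderiv ℝ f x u) := fun u => by fun_prop
  have hsd : ∀ u, HasCompactSupport (fun x => fderiv ℝ f x u) := fun u => hcs.fderiv_apply ℝ u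
  have hi0 : Integrable (fun x => |f x| ^ 2) := by
    simp only [sq_abs]
    exact Continuous.integrable_of_hasCompactSupport (hfc.pow 2) (aux_sq hcs)
  have hi1 : ∀ u, Integrable (fun x => (fderiv ℝ f x u) ^ 2) := fun u => by
    apply Continuous.integrable_of_hasCompactSupport ((hcd u).pow 2)
    exact aux_sq (hsd u)
  let F : ℝ × ℝ → ENNReal := fun x => ENNReal.ofReal (f x ^ 2 + fderiv ℝ f x w ^ 2)
  have hFc : Continuous F := by
    have := hcd w
    exact ENNReal.continuous_ofReal.comp (by fun_prop)
  have hFL : Measurable (fun p => F (L p)) := (hFc.comp L.continuous).measurable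
  have step1 : volume ((fun x => (L.symm x).1) '' O) ≤ ∫⁻ s : ℝ, ∫⁻ t : ℝ, F (L (s, t)) := by
    have hm := mul_meas_ge_le_lintegral (μ := (volume : Measure ℝ))
      (f := fun s : ℝ => ∫⁻ t : ℝ, F (L (s, t))) (hFL.lintegral_prod_right') 1
    rw [one_mul] at hm
    refine le_trans (measure_mono ?_) hm
    rintro _ ⟨x, hx, rfl⟩
    simp only [Set.mem_ofPred_eq]
    set s := (L.symm x).1
    have hderiv : ∀ t, HasDerivAt (fun t => f (L (s, t))) (fderiv ℝ f (L (s, t)) w) t := by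
      intro t
      have h1 : HasDerivAt (fun t : ℝ => (s, t)) ((0 : ℝ), (1 : ℝ)) t :=
        (hasDerivAt_const t s).prodMk (hasDerivAt_id t)
      have h2 : HasDerivAt (fun t : ℝ => L (s, t)) w t :=
        (L.hasFDerivAt (x := (s, t))).comp_hasDerivAt t h1
      exact ((hf1.differentiable one_ne_zero) (L (s, t))).hasFDerivAt.comp_hasDerivAt t h2
    have := aux_one_dim (fun t => f (L (s, t))) ?_ ?_ (L.symm x).2 ?_
    · refine this.trans (le_of_eq ?_)
      refine lintegral_congr fun t => ?_
      simp only [F, (hderiv t).deriv]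
    · exact hf1.comp (L.contDiff.comp (contDiff_const.prodMk contDiff_id))
    · have hemb : Topology.IsClosedEmbedding (fun t : ℝ => L (s, t)) :=
        by
        refine L.toHomeomorph.isClosedEmbedding.comp (g := L) (f := fun t : ℝ => (s, t)) ?_
        refine Topology.IsClosedEmbedding.of_continuous_injective_isClosedMap (by fun_prop)
          (fun _ _ h => (Prod.ext_iff.1 h).2) fun S hS => ?_
        have : (fun t : ℝ => (s, t)) '' S = {s} ×ˢ S := Set.singleton_prod.symm
        rw [this]
        exact isClosed_singleton.prod hS
      exact hcs.comp_isClosedEmbedding hemb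
    · simp only [s, Prod.mk.eta, ContinuousLinearEquiv.apply_symm_apply]
      exact hO x hx
  have step2 : ∫⁻ s : ℝ, ∫⁻ t : ℝ, F (L (s, t)) = c * ∫⁻ x, F x := by
    rw [← lintegral_prod (fun p : ℝ × ℝ => F (L p)) hFL.aemeasurable, ← Measure.volume_eq_prod,
      ← lintegral_map hFc.measurable L.continuous.measurable, hc, lintegral_smul_measure]
    rfl
  have step3 : ∫⁻ x, F x ≤ K * ENNReal.ofReal ((∫ x : ℝ × ℝ, |f x| ^ 2) +
            (∫ x : ℝ × ℝ, (fderiv ℝ f x (1, 0)) ^ 2 + (fderiv ℝ f x (0, 1)) ^ 2)) := by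
    have hi2 := (hi1 (1, 0)).add (hi1 (0, 1))
    have hi3 : Integrable (fun x => |f x| ^ 2 +
      ((fderiv ℝ f x) (1, 0) ^ 2 + (fderiv ℝ f x) (0, 1) ^ 2)) := hi0.add hi2
    have e := integral_add hi0 hi2
    simp only [Pi.add_apply] at e
    rw [← e, ofReal_integral_eq_lintegral_ofReal hi3
      (Filter.Eventually.of_forall fun t => by positivity),
      ← lintegral_const_mul' _ _ ENNReal.coe_ne_top]
    refine lintegral_mono fun x => ?_
    simp only [F]
    rw [← ENNReal.ofReal_coe_nnreal, ← ENNReal.ofReal_mul (by positivity)]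
    apply ENNReal.ofReal_le_ofReal
    have hwd : fderiv ℝ f x w = w.1 * fderiv ℝ f x (1, 0) + w.2 * fderiv ℝ f x (0, 1) := by
      have : w = w.1 • ((1:ℝ), (0:ℝ)) + w.2 • ((0:ℝ), (1:ℝ)) := by ext <;> simp
      conv_lhs => rw [this, map_add, map_smul, map_smul]
      rfl
    rw [hwd, hKr, sq_abs]
    generalize fderiv ℝ f x (1, 0) = A
    generalize fderiv ℝ f x (0, 1) = B
    generalize f x = y
    generalize w.1 = p
    generalize w.2 = q
    nlinarith [sq_nonneg (p * A - q * B), sq_nonneg (p * B), sq_nonneg (q * A), sq_nonneg (p * y),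
      sq_nonneg (q * y), sq_nonneg A, sq_nonneg B]
  calc _ ≤ _ := step1
    _ = _ := step2
    _ ≤ c * (K * _) := by gcongr
    _ = _ := by rw [← mul_assoc]; push_cast; rfl

/-- Lemma A.1: if a compact set `𝒪 ⊆ ℝ²` is polar (smooth functions supported away from
`𝒪` approximate every smooth compactly supported function in the `H¹` norm), then the
projection of `𝒪` onto any line has one-dimensional Lebesgue measure zero. -/
theorem polar_implies_projections_null
    (𝒪 : Set (ℝ × ℝ)) (h𝒪 : IsCompact 𝒪)
    (hpolar : ∀ φ : ℝ × ℝ → ℝ, ContDiff ℝ (⊤ : ℕ∞) φ → HasCompactSupport φ →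
      ∀ ε : ℝ, 0 < ε →
        ∃ ψ : ℝ × ℝ → ℝ, ContDiff ℝ (⊤ : ℕ∞) ψ ∧ HasCompactSupport ψ ∧
          tsupport ψ ∩ 𝒪 = ∅ ∧
          (∫ x : ℝ × ℝ, |φ x - ψ x| ^ 2) +
            (∫ x : ℝ × ℝ,
              (fderiv ℝ (φ - ψ) x (1, 0)) ^ 2 + (fderiv ℝ (φ - ψ) x (0, 1)) ^ 2) < ε) :
    ∀ v : ℝ × ℝ, volume ((fun x : ℝ × ℝ => x.1 * v.1 + x.2 * v.2) '' 𝒪) = 0 := by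
  rintro ⟨a, b⟩
  by_cases hab : a ^ 2 + b ^ 2 = 0
  · have ha : a = 0 := by nlinarith [sq_nonneg a, sq_nonneg b]
    have hb : b = 0 := by nlinarith [sq_nonneg a, sq_nonneg b]
    subst ha hb
    refine measure_mono_null (t := {0}) ?_ (by simp)
    rintro _ ⟨x, _, rfl⟩
    simp
  obtain ⟨C, hC⟩ := aux_main (auxL a b hab)
  obtain ⟨R, hR0, hR⟩ : ∃ R : ℝ, 0 < R ∧ 𝒪 ⊆ Metric.closedBall 0 R := by
    obtain ⟨R, hR⟩ := h𝒪.isBounded.subset_closedBall 0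
    exact ⟨max R 1, by positivity, hR.trans (Metric.closedBall_subset_closedBall (le_max_left _ _))⟩
  let φ : ContDiffBump (0 : ℝ × ℝ) := ⟨R, R + 1, hR0, by linarith⟩
  have hbound : ∀ ε : ℝ, 0 < ε →
      volume ((fun x : ℝ × ℝ => x.1 * a + x.2 * b) '' 𝒪) ≤ C * ENNReal.ofReal ε := by
    intro ε hε
    obtain ⟨ψ, hψ, hψc, hd, hlt⟩ := hpolar φ φ.contDiff φ.hasCompactSupport ε hε
    have h := hC (φ - ψ) (φ.contDiff.sub hψ) (φ.hasCompactSupport.sub hψc) 𝒪 ?_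
    · refine h.trans ?_
      gcongr
      exact hlt.le
    · intro x hx
      have h1 : φ x = 1 := φ.one_of_mem_closedBall (hR hx)
      have h2 : ψ x = 0 := by
        by_contra hne
        have : x ∈ tsupport ψ ∩ 𝒪 := ⟨subset_tsupport _ hne, hx⟩
        rw [hd] at this
        exact this
      simp [h1, h2]
  have hlim : Filter.Tendsto (fun ε : ℝ => (C : ENNReal) * ENNReal.ofReal ε)
      (nhdsWithin 0 (Set.Ioi 0)) (nhds 0) := by
    have h1 : Filter.Tendsto (fun ε : ℝ => ENNReal.ofReal ε) (nhds 0) (nhds 0) := by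
      simpa using ENNReal.continuous_ofReal.tendsto (0 : ℝ)
    have h2 := ENNReal.Tendsto.const_mul (a := (C : ENNReal)) h1 (Or.inr ENNReal.coe_ne_top)
    rw [mul_zero] at h2
    exact h2.mono_left nhdsWithin_le_nhds
  refine le_antisymm (ge_of_tendsto hlim ?_) bot_le
  filter_upwards [self_mem_nhdsWithin] with ε hε
  exact hbound ε hε
end

section
/- Lemma B.1, first conclusion (uniform absolute convergence of log-series on sectors): let N ∈ ℕ, let (B, ‖·‖) be a Banach space, and let V : ℕ × ℤ → B satisfy V(j,k) = 0 whenever j = 0 or k > N·j. Let ν₀ ∈ (0,1) and assume the family (j,k) ↦ ‖V(j,k)‖ · |log ν₀|^k · ν₀^j is summable over ℕ × ℤ. Then for every φ > 0 there exist ν₁ ∈ (0,1) and a summable family M : ℕ × ℤ → ℝ such that for all (j,k) ∈ ℕ × ℤ and every s ∈ ℂ with Re s < log ν₁ and |Im s| < φ, one has ‖V(j,k)‖ · |s^k · e^{j s}| ≤ M(j,k). In particular the series Σ_{j,k} V(j,k) (log ν)^k ν^j converges absolutely in B, uniformly on the sector {ν ∈ Λ : 0 < |ν| < ν₁, |arg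 ν| < φ}. -/
/-- Lemma B.1, first conclusion: uniform absolute convergence on sectors of the
log-series `Σ V(j,k) (log ν)^k ν^j`, written in the chart `s = log ν` on the Riemann
surface of the logarithm (so `ν = e^s`). -/
theorem log_series_uniform_convergence
    (N : ℕ) (B : Type*) [NormedAddCommGroup B] [CompleteSpace B]
    [NormedSpace ℂ B]
    (V : ℕ × ℤ → B)
    (hV : ∀ (j : ℕ) (k : ℤ), j = 0 ∨ (N : ℤ) * (j : ℤ) < k → V (j, k) = 0)
    (ν₀ : ℝ) (hν₀ : ν₀ ∈ Set.Ioo (0 : ℝ) 1)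
    (hsum : Summable fun p : ℕ × ℤ => ‖V p‖ * |Real.log ν₀| ^ p.2 * ν₀ ^ p.1) :
    ∀ φ : ℝ, 0 < φ →
      ∃ ν₁ ∈ Set.Ioo (0 : ℝ) 1, ∃ M : ℕ × ℤ → ℝ, Summable M ∧
        ∀ p : ℕ × ℤ, ∀ s : ℂ, s.re < Real.log ν₁ → |s.im| < φ →
          ‖V p‖ * ‖s ^ p.2 * Complex.exp ((p.1 : ℂ) * s)‖ ≤ M p := by
  intro φ hφ
  obtain ⟨h0, h1⟩ := hν₀
  have hlog : Real.log ν₀ < 0 := Real.log_neg h0 h1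
  set L : ℝ := |Real.log ν₀| with hL
  have hLpos : 0 < L := abs_pos.mpr hlog.ne
  have hν : ν₀ = Real.exp (-L) := by
    rw [hL, abs_of_neg hlog, neg_neg, Real.exp_log h0]
  have hc : 0 < L ^ N * Real.exp (-L) * Real.exp (-φ) := by positivity
  obtain ⟨A, hA⟩ := Filter.eventually_atTop.mp
    ((Real.tendsto_pow_mul_exp_neg_atTop_nhds_zero N).eventually_lt_const hc)
  set T : ℝ := max A L with hT
  have hTL : L ≤ T := le_max_right _ _
  have hTA : A ≤ T := le_max_left _ _
  refine ⟨Real.exp (-T), ⟨Real.exp_pos _, Real.exp_lt_one_iff.mpr (by linarith)⟩, _, hsum, ?_⟩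
  rintro ⟨j, k⟩ s hre him
  rw [Real.log_exp] at hre
  by_cases hjk : j = 0 ∨ (N : ℤ) * (j : ℤ) < k
  · simp [hV j k hjk]
  push Not at hjk
  obtain ⟨-, hk⟩ := hjk
  simp only
  rw [mul_assoc]
  refine mul_le_mul_of_nonneg_left ?_ (norm_nonneg _)
  have hs1 : L ≤ ‖s‖ := by
    have := Complex.abs_re_le_norm s
    have := neg_le_abs s.re
    linarith
  have hs2 : ‖s‖ ≤ -s.re + φ := by
    have := Complex.norm_le_abs_re_add_abs_im s
    rw [abs_of_neg (show s.re < 0 by linarith)] at this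
    linarith
  have hkey := hA (-s.re + φ) (by linarith)
  have hb : ‖s‖ ^ N * Real.exp s.re ≤ L ^ N * ν₀ := by
    have e1 : ‖s‖ ^ N ≤ (-s.re + φ) ^ N := by gcongr
    have e2 : Real.exp (-(-s.re + φ)) = Real.exp s.re * Real.exp (-φ) := by
      rw [← Real.exp_add]; congr 1; ring
    rw [e2, ← mul_assoc] at hkey
    have := lt_of_mul_lt_mul_right hkey (Real.exp_pos _).le
    rw [hν]
    exact (mul_le_mul_of_nonneg_right e1 (Real.exp_pos _).le).trans this.le
  have hr : 1 ≤ ‖s‖ / L := (one_le_div hLpos).mpr hs1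
  have hrk : (‖s‖ / L) ^ k ≤ (‖s‖ / L) ^ (N * j) := by
    have := zpow_le_zpow_right₀ hr hk
    exact_mod_cast this
  have hb2 : (‖s‖ / L) ^ N * Real.exp s.re ≤ ν₀ := by
    rw [div_pow, div_mul_eq_mul_div, div_le_iff₀ (by positivity)]
    linarith
  have hsk : ‖s‖ ^ k = L ^ k * (‖s‖ / L) ^ k := by
    rw [← mul_zpow, mul_div_cancel₀ _ hLpos.ne']
  have hexp : ‖Complex.exp ((j : ℂ) * s)‖ = Real.exp s.re ^ j := by
    rw [Complex.exp_nat_mul, norm_pow, Complex.norm_exp]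
  rw [norm_mul, norm_zpow, hexp, hsk, mul_assoc]
  refine mul_le_mul_of_nonneg_left ?_ (by positivity)
  calc (‖s‖ / L) ^ k * Real.exp s.re ^ j
      ≤ (‖s‖ / L) ^ (N * j) * Real.exp s.re ^ j := by gcongr
    _ = ((‖s‖ / L) ^ N * Real.exp s.re) ^ j := by rw [pow_mul, mul_pow]
    _ ≤ ν₀ ^ j := by gcongr
end

section
/- Lemma B.1, second conclusion (uniform absolute convergence of the differentiated log-series): let N ∈ ℕ, let (B, ‖·‖) be a Banach space, and let V : ℕ × ℤ → B satisfy V(j,k) = 0 whenever j ≤ 1 or k > N·j. Let ν₀ ∈ (0,1) and assume the family (j,k) ↦ ‖V(j,k)‖ · |log ν₀|^k · ν₀^j is summable over ℕ × ℤ. Then for every φ > 0 there exist ν₁ ∈ (0,1) and a summable family M : ℕ × ℤ → ℝ such that for all (j,k) ∈ ℕ × ℤ and every s ∈ ℂ with Re s < log ν₁ and |Im s| < φ, one has ‖V(j,k)‖ · |(k + j·s) · s^{k−1} · e^{(j−1)s}| ≤ M(j,k). In particular the term-by-term derivative series Σ_{j,k} V(j,k) (k + j log ν)(log ν)^{k−1}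 ν^{j−1} converges absolutely in B, uniformly on the sector {ν ∈ Λ : 0 < |ν| < ν₁, |arg ν| < φ}. -/
lemma aux_key (N j : ℕ) (k : ℤ) (hk : k ≤ (N : ℤ) * j) (ρ : ℝ) (hρ : 2 ≤ ρ) :
    (|(k : ℝ)| + j) * ρ ^ k ≤ (N + 1) * (Real.exp 1 * ρ ^ N) ^ j := by
  have hj : (j : ℝ) + 1 ≤ Real.exp 1 ^ j := by
    rw [← Real.exp_nat_mul, mul_one]; exact Real.add_one_le_exp _
  have hρN : 1 ≤ (ρ ^ N) ^ j := one_le_pow₀ (one_le_pow₀ (by linarith))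
  have hN : (0 : ℝ) ≤ N := Nat.cast_nonneg N
  have hj0 : (0 : ℝ) ≤ j := Nat.cast_nonneg j
  rw [mul_pow]
  rcases le_or_gt 0 k with h0 | h0
  · have h1 : ρ ^ k ≤ (ρ ^ N) ^ j := by
      rw [← pow_mul, ← zpow_natCast]
      exact zpow_le_zpow_right₀ (by linarith) (by push_cast; exact hk)
    have h2 : |(k : ℝ)| ≤ N * j := by
      rw [abs_of_nonneg (by exact_mod_cast h0)]; exact_mod_cast hk
    have h3 : |(k : ℝ)| + j ≤ (N + 1) * Real.exp 1 ^ j := by nlinarith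
    calc _ ≤ ((N + 1) * Real.exp 1 ^ j) * (ρ ^ N) ^ j := by gcongr
      _ = _ := by ring
  · obtain ⟨n, rfl⟩ : ∃ n : ℕ, k = -(n : ℤ) := ⟨k.natAbs, by omega⟩
    have h1 : (n : ℝ) + 1 ≤ 2 ^ n := by exact_mod_cast Nat.lt_two_pow_self
    have h2 : (2 : ℝ) ^ n ≤ ρ ^ n := by gcongr
    have h3 : (0 : ℝ) < ρ ^ n := by positivity
    have h4 : (1 : ℝ) ≤ ρ ^ n := by linarith [Nat.cast_nonneg (α := ℝ) n]
    have h5 : (|((-(n : ℤ) : ℤ) : ℝ)| + j) * ρ ^ (-(n : ℤ)) ≤ j + 1 := by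
      rw [zpow_neg, zpow_natCast, ← div_eq_mul_inv, div_le_iff₀ h3]
      push_cast
      rw [abs_neg, abs_of_nonneg (Nat.cast_nonneg n)]
      nlinarith
    have h6 : Real.exp 1 ^ j ≤ Real.exp 1 ^ j * (ρ ^ N) ^ j :=
      le_mul_of_one_le_right (by positivity) hρN
    have h7 : 0 ≤ N * (Real.exp 1 ^ j * (ρ ^ N) ^ j) := by positivity
    linarith

lemma aux_X (N : ℕ) (L φ : ℝ) (hL : 0 < L) : ∃ X : ℝ, 1 ≤ X ∧ φ ≤ X ∧ 2 * L ≤ X ∧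
    ∀ x : ℝ, X ≤ x → Real.exp 1 * (2 * x / L) ^ N * Real.exp (-(x / 2)) ≤ Real.exp (-L) := by
  have h := (isLittleO_pow_exp_pos_mul_atTop N (b := 1 / 2) (by norm_num)).def
    (c := Real.exp (-L) / (Real.exp 1 * (2 / L) ^ N)) (by positivity)
  obtain ⟨X, hX⟩ := Filter.eventually_atTop.1 h
  refine ⟨max (max X 1) (max φ (2 * L)), by simp, by simp, by simp, fun x hx => ?_⟩
  simp only [max_le_iff] at hx
  have h1 := hX x hx.1.1
  have hx0 : 0 < x := by linarith
  rw [Real.norm_of_nonneg (by positivity), Real.norm_of_nonneg (by positivity), div_mul_eq_mul_div,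
    le_div_iff₀ (by positivity)] at h1
  rw [Real.exp_neg (x / 2), ← div_eq_mul_inv, div_le_iff₀ (by positivity)]
  calc _ = x ^ N * (Real.exp 1 * (2 / L) ^ N) := by
        rw [show 2 * x / L = x * (2 / L) by ring, mul_pow]; ring
    _ ≤ _ := h1
    _ = _ := by rw [show 1 / 2 * x = x / 2 by ring]

lemma aux_main_s6 (N j : ℕ) (k : ℤ) (hj : 2 ≤ j) (hk : k ≤ (N : ℤ) * j) (L φ X : ℝ) (hL : 0 < L)
    (h1 : 1 ≤ X) (h2 : φ ≤ X) (h3 : 2 * L ≤ X)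
    (hX : ∀ x : ℝ, X ≤ x → Real.exp 1 * (2 * x / L) ^ N * Real.exp (-(x / 2)) ≤ Real.exp (-L))
    (s : ℂ) (hre : s.re < -X) (him : |s.im| < φ) :
    ‖((k : ℂ) + (j : ℂ) * s) * s ^ (k - 1) * Complex.exp (((j : ℂ) - 1) * s)‖ ≤
      (N + 1) * (L ^ k * Real.exp (-L) ^ j) := by
  obtain ⟨x, hx⟩ : ∃ x, x = -s.re := ⟨_, rfl⟩
  have hr1 : x ≤ ‖s‖ := by
    rw [hx]; exact (neg_le_abs _).trans (Complex.abs_re_le_norm s)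
  have hr2 : ‖s‖ ≤ 2 * x := by
    have := Complex.norm_le_abs_re_add_abs_im s
    rw [abs_of_neg (by linarith : s.re < 0)] at this
    linarith
  have hs0 : 0 < ‖s‖ := by linarith
  have hj2 : (2 : ℝ) ≤ j := by exact_mod_cast hj
  rw [norm_mul, norm_mul, norm_zpow, Complex.norm_exp]
  have e1 : (((j : ℂ) - 1) * s).re ≤ j * (-(x / 2)) := by
    have : (((j : ℂ) - 1) * s).re = ((j : ℝ) - 1) * s.re := by simp
    rw [this]; nlinarith
  have e2 : ‖(k : ℂ) + (j : ℂ) * s‖ ≤ (|(k : ℝ)| + j) * ‖s‖ := by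
    refine (norm_add_le _ _).trans ?_
    rw [norm_mul, Complex.norm_natCast, Complex.norm_intCast]
    nlinarith [abs_nonneg (k : ℝ)]
  have key := aux_key N j k hk (‖s‖ / L) (by rw [le_div_iff₀ hL]; linarith)
  have e3 : ‖s‖ ^ k = (‖s‖ / L) ^ k * L ^ k := by
    rw [← mul_zpow, div_mul_cancel₀ _ hL.ne']
  calc _ ≤ ((|(k : ℝ)| + j) * ‖s‖) * ‖s‖ ^ (k - 1) * Real.exp (j * (-(x / 2))) := by gcongr
    _ = ((|(k : ℝ)| + j) * (‖s‖ / L) ^ k) * L ^ k * Real.exp (-(x / 2)) ^ j := by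
      rw [mul_assoc _ ‖s‖, ← zpow_one_add₀ hs0.ne', Real.exp_nat_mul,
        show 1 + (k - 1) = k by ring, e3]; ring
    _ ≤ ((N + 1) * (Real.exp 1 * (‖s‖ / L) ^ N) ^ j) * L ^ k * Real.exp (-(x / 2)) ^ j := by
      gcongr
    _ = (N + 1) * (L ^ k * (Real.exp 1 * (‖s‖ / L) ^ N * Real.exp (-(x / 2))) ^ j) := by
      rw [mul_pow _ (Real.exp (-(x / 2)))]; ring
    _ ≤ (N + 1) * (L ^ k * (Real.exp 1 * (2 * x / L) ^ N * Real.exp (-(x / 2))) ^ j) := by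
      gcongr
    _ ≤ _ := by
      have := hX x (by linarith)
      have hx0 : 0 < x := by linarith
      gcongr

/-- Lemma B.1, second conclusion: uniform absolute convergence on sectors of the
term-by-term differentiated log-series `Σ V(j,k) (k + j log ν)(log ν)^{k-1} ν^{j-1}`,
written in the chart `s = log ν` on the Riemann surface of the logarithm. -/
theorem log_series_derivative_uniform_convergence
    (N : ℕ) (B : Type*) [NormedAddCommGroup B] [CompleteSpace B]
    [NormedSpace ℂ B]
    (V : ℕ × ℤ → B)
    (hV : ∀ (j : ℕ) (k : ℤ), j ≤ 1 ∨ (N : ℤ) * (j : ℤ) < k → V (j, k) = 0)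
    (ν₀ : ℝ) (hν₀ : ν₀ ∈ Set.Ioo (0 : ℝ) 1)
    (hsum : Summable fun p : ℕ × ℤ => ‖V p‖ * |Real.log ν₀| ^ p.2 * ν₀ ^ p.1) :
    ∀ φ : ℝ, 0 < φ →
      ∃ ν₁ ∈ Set.Ioo (0 : ℝ) 1, ∃ M : ℕ × ℤ → ℝ, Summable M ∧
        ∀ p : ℕ × ℤ, ∀ s : ℂ, s.re < Real.log ν₁ → |s.im| < φ →
          ‖V p‖ * ‖((p.2 : ℂ) + (p.1 : ℂ) * s) * s ^ (p.2 - 1) *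
            Complex.exp (((p.1 : ℂ) - 1) * s)‖ ≤ M p := by
  intro φ _
  have hlog : Real.log ν₀ < 0 := Real.log_neg hν₀.1 hν₀.2
  have hL : 0 < |Real.log ν₀| := abs_pos.2 hlog.ne
  have hexp : Real.exp (-|Real.log ν₀|) = ν₀ := by
    rw [abs_of_neg hlog, neg_neg, Real.exp_log hν₀.1]
  obtain ⟨X, h1, h2, h3, hX⟩ := aux_X N |Real.log ν₀| φ hL
  refine ⟨Real.exp (-X), ⟨Real.exp_pos _, (by rw [← Real.exp_zero]; exact Real.exp_lt_exp.2 (by linarith))⟩, _,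
    hsum.mul_left ((N : ℝ) + 1), ?_⟩
  rintro ⟨j, k⟩ s hre him
  rw [Real.log_exp] at hre
  by_cases hjk : j ≤ 1 ∨ (N : ℤ) * (j : ℤ) < k
  · simp [hV j k hjk]
  · simp only [not_or, not_le, not_lt] at hjk
    have := aux_main_s6 N j k hjk.1 hjk.2 _ φ X hL h1 h2 h3 hX s hre him
    rw [hexp] at this
    calc _ ≤ ‖V (j, k)‖ * ((N + 1) * (|Real.log ν₀| ^ k * ν₀ ^ j)) :=
          mul_le_mul_of_nonneg_left this (norm_nonneg _)
      _ = _ := by ring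
end
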